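/- Let n ≥ 2. For every δ > 0 and constants K₁, K₂, K₃ > 0 there exists a constant C > 0, depending only on n, δ, K₁, K₂, K₃, with the following property: if Ω ⊆ ℝⁿ is a bounded open convex set with B_{1/n}(0) ⊆ Ω ⊆ B₁(0), u ∈ C⁴(Ω) ∩ C⁰(Ω̄) is locally uniformly convex in Ω, u = 0 on ∂Ω, L[u] = f in Ω, and sup_Ω |Du| ≤ K₁, sup_Ω f ≤ K₂, sup_Ω |u| ≤ K₃, then det D²u(x) ≤ C for every x ∈ Ω with dist(x, ∂Ω) ≥ δ. -/

import Mathlib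

open MeasureTheory

noncomputable section

/-- `ℝⁿ` with the Euclidean structure. -/
abbrev E (n : ℕ) := EuclideanSpace ℝ (Fin n)

/-- The Hessian matrix `D²u(x)` of second partial derivatives. -/
noncomputable def Hess {n : ℕ} (u : E n → ℝ) (x : E n) : Matrix (Fin n) (Fin n) ℝ :=
  fun i j => iteratedFDeriv ℝ 2 u x ![EuclideanSpace.single i 1, EuclideanSpace.single j 1]

/-- `w(x) = (det D²u(x))^(-(n+1)/(n+2))`. -/
noncomputable def wFn (n : ℕ) (u : E n → ℝ) (x : E n) : ℝ :=
  (Hess u x).det ^ (-(n + 1 : ℝ) / (n + 2))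

/-- The affine maximal surface operator `L[u](x) = ∑ᵢⱼ Uⁱʲ(x) ∂²w/∂xᵢ∂xⱼ(x)`,
where `[Uⁱʲ]` is the cofactor (= adjugate, by symmetry of the Hessian) matrix of `D²u`. -/
noncomputable def Lop (n : ℕ) (u : E n → ℝ) (x : E n) : ℝ :=
  ∑ i, ∑ j, (Hess u x).adjugate i j *
    iteratedFDeriv ℝ 2 (wFn n u) x ![EuclideanSpace.single i 1, EuclideanSpace.single j 1]

section LinearAlgebra

open Matrix

variable {n : ℕ}

theorem det_le_trace_pow {H : Matrix (Fin n) (Fin n) ℝ} (hH : H.PosDef) :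
    H.det ≤ H.trace ^ n := by
  have hdet := hH.isHermitian.det_eq_prod_eigenvalues
  have htr := hH.isHermitian.trace_eq_sum_eigenvalues
  simp only [RCLike.ofReal_real_eq_id, id_eq] at hdet htr
  have hpos := fun i => (hH.eigenvalues_pos i).le
  rw [hdet, htr]
  calc ∏ i, hH.isHermitian.eigenvalues i
      ≤ ∏ _i : Fin n, ∑ j, hH.isHermitian.eigenvalues j :=
        Finset.prod_le_prod (fun i _ => hpos i) fun i _ =>
          Finset.single_le_sum (fun j _ => hpos j) (Finset.mem_univ i)
    _ = _ := by simp

theorem posSemidef_adjugate {H : Matrix (Fin n) (Fin n) ℝ} (hH : H.PosDef) :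
    H.adjugate.PosSemidef := by
  have h : H.adjugate = H.det • H⁻¹ := by
    rw [Matrix.inv_def, smul_smul, Ring.mul_inverse_cancel _ hH.det_pos.ne'.isUnit, one_smul]
  rw [h]
  exact hH.inv.posSemidef.smul hH.det_pos.le

theorem sum_mul_nonneg_of_posSemidef {U G : Matrix (Fin n) (Fin n) ℝ}
    (hU : U.PosSemidef) (hG : ∀ v : Fin n → ℝ, 0 ≤ ∑ i, ∑ j, v i * v j * G i j) :
    0 ≤ ∑ i, ∑ j, U i j * G i j := by
  obtain ⟨m, A, rfl⟩ := Matrix.posSemidef_iff_eq_sum_vecMulVec.mp hU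
  have : ∑ i, ∑ j, (∑ k, vecMulVec (A k) (star (A k))) i j * G i j
      = ∑ k, ∑ i, ∑ j, A k i * A k j * G i j := by
    simp only [Matrix.sum_apply, vecMulVec_apply, star_trivial, Finset.sum_mul]
    rw [Finset.sum_comm]
    simp_rw [Finset.sum_comm (s := (Finset.univ : Finset (Fin n)))
      (t := (Finset.univ : Finset (Fin m)))]
    exact Finset.sum_congr rfl fun k _ => Finset.sum_comm
  rw [this]
  exact Finset.sum_nonneg fun k _ => hG (A k)

theorem sum_sum_mul_mul_eq_dotProduct (U : Matrix (Fin n) (Fin n) ℝ) (a b : Fin n → ℝ) :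
    ∑ i, ∑ j, U i j * (a i * b j) = a ⬝ᵥ U *ᵥ b := by
  simp only [dotProduct, mulVec, Finset.mul_sum]
  exact Finset.sum_congr rfl fun i _ => Finset.sum_congr rfl fun j _ => by ring

theorem sum_sum_mul_eq_trace {U M : Matrix (Fin n) (Fin n) ℝ} (hM : M.IsHermitian) :
    ∑ i, ∑ j, U i j * M i j = (U * M).trace := by
  simp only [Matrix.trace, Matrix.diag, Matrix.mul_apply]
  refine Finset.sum_congr rfl fun i _ => Finset.sum_congr rfl fun j _ => ?_
  rw [← hM.apply i j, star_trivial]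

/-- The pointwise inequality obtained from the first and second order conditions at a minimum of
`ρ S + c u`, where `H` plays the role of the Hessian of `u` and `T` of its third derivatives. -/
theorem trace_le_of_critical {H R G : Matrix (Fin n) (Fin n) ℝ}
    {T : Fin n → Matrix (Fin n) (Fin n) ℝ} {a ξ p : Fin n → ℝ} {S c ρ f ε : ℝ} (hH : H.PosDef)
    (hS : 0 < S) (hρ : 0 < ρ) (hD : H.det * ρ ^ (n + 2) = 1)
    (hG : ∀ i j, G i j = S * R i j + (a i * (H *ᵥ ξ) j + (H *ᵥ ξ) i * a j)
      + ρ * (H i j - 2 * ε * (H * H) i j + ∑ k, ξ k * T k i j) + c * H i j)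
    (hG0 : 0 ≤ ∑ i, ∑ j, H.adjugate i j * G i j)
    (hcrit : ∀ i, S * a i + ρ * (H *ᵥ ξ) i + c * p i = 0)
    (hT : ∀ k, (n + 2) * H.det * a k + ρ * ∑ i, ∑ j, H.adjugate i j * T k i j = 0)
    (hL : ∑ i, ∑ j, H.adjugate i j * ((n + 1) * ρ ^ n * R i j
      + n * (n + 1) * ρ ^ (n - 1) * (a i * a j)) = f) :
    2 * ε * H.trace ≤ S * f * ρ / (n + 1) + n + n * c / ρ * (1 - ξ ⬝ᵥ p / S) := by
  have hDpos := hH.det_pos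
  set D := H.det with hDdef
  set U := H.adjugate with hU
  have hsymm : H.IsHermitian := hH.isHermitian
  have hUH : U * H = D • 1 := Matrix.adjugate_mul H
  have hUHv : ∀ v, U *ᵥ (H *ᵥ v) = D • v := fun v => by
    rw [mulVec_mulVec, hUH, smul_mulVec, one_mulVec]
  have hvU : ∀ v w, (H *ᵥ v) ⬝ᵥ U *ᵥ w = D * (v ⬝ᵥ w) := fun v w => by
    have hHt : Hᵀ = H := by simpa [IsHermitian] using hsymm
    rw [dotProduct_mulVec, ← mulVec_transpose, hU, Matrix.adjugate_transpose, hHt, ← hU, hUHv,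
      smul_dotProduct, smul_eq_mul]
  set r := ∑ i, ∑ j, U i j * R i j with hr
  set t := ∑ k, ξ k * ∑ i, ∑ j, U i j * T k i j with ht
  have hBp : 0 ≤ p ⬝ᵥ U *ᵥ p := by
    simpa using (posSemidef_adjugate hH).dotProduct_mulVec_nonneg p
  have e1 : 0 ≤ S * r + 2 * D * (a ⬝ᵥ ξ) + ρ * (n * D - 2 * ε * (D * H.trace) + t)
      + c * (n * D) := by
    have h1 : ∑ i, ∑ j, U i j * H i j = n * D := by
      rw [sum_sum_mul_eq_trace hsymm, hUH, trace_smul, trace_one]; simp [mul_comm]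
    have h2 : ∑ i, ∑ j, U i j * (H * H) i j = D * H.trace := by
      rw [sum_sum_mul_eq_trace, ← Matrix.mul_assoc, hUH, Matrix.smul_mul, Matrix.one_mul,
        trace_smul, smul_eq_mul]
      rw [IsHermitian, conjTranspose_mul, hsymm.eq]
    have h3 : ∑ i, ∑ j, U i j * (a i * (H *ᵥ ξ) j) = D * (a ⬝ᵥ ξ) := by
      rw [sum_sum_mul_mul_eq_dotProduct, hUHv, dotProduct_smul, smul_eq_mul]
    have h4 : ∑ i, ∑ j, U i j * ((H *ᵥ ξ) i * a j) = D * (a ⬝ᵥ ξ) := by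
      rw [sum_sum_mul_mul_eq_dotProduct, hvU, dotProduct_comm]
    have h5 : ∑ i, ∑ j, U i j * ∑ k, ξ k * T k i j = t := by
      simp only [ht, Finset.mul_sum]
      refine .trans (Finset.sum_congr rfl fun i _ => Finset.sum_comm) ?_
      rw [Finset.sum_comm]
      exact Finset.sum_congr rfl fun k _ => Finset.sum_congr rfl fun i _ =>
        Finset.sum_congr rfl fun j _ => by ring
    have : ∑ i, ∑ j, U i j * G i j = S * r + 2 * D * (a ⬝ᵥ ξ)
        + ρ * (n * D - 2 * ε * (D * H.trace) + t) + c * (n * D) := by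
      calc ∑ i, ∑ j, U i j * G i j
          = ∑ i, ∑ j, (S * (U i j * R i j) + (U i j * (a i * (H *ᵥ ξ) j)
            + U i j * ((H *ᵥ ξ) i * a j)) + ρ * (U i j * H i j
            - 2 * ε * (U i j * (H * H) i j) + U i j * ∑ k, ξ k * T k i j)
            + c * (U i j * H i j)) :=
            Finset.sum_congr rfl fun i _ => Finset.sum_congr rfl fun j _ => by rw [hG]; ring
        _ = _ := by
            simp only [Finset.sum_add_distrib, Finset.sum_sub_distrib, ← Finset.mul_sum]
            rw [h1, h2, h3, h4, h5, ← hr]; ring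
    rwa [this] at hG0
  have e2 : (n + 2) * D * (a ⬝ᵥ ξ) + ρ * t = 0 := by
    have : (n + 2) * D * (a ⬝ᵥ ξ) + ρ * t
        = ∑ k, ξ k * ((n + 2) * D * a k + ρ * ∑ i, ∑ j, U i j * T k i j) := by
      rw [ht, dotProduct, Finset.mul_sum, Finset.mul_sum, ← Finset.sum_add_distrib]
      exact Finset.sum_congr rfl fun k _ => by ring
    rw [this]
    exact Finset.sum_eq_zero fun k _ => by rw [hT k, mul_zero]
  have e3 : (n + 1) * ρ ^ n * r + n * (n + 1) * ρ ^ (n - 1) * (a ⬝ᵥ U *ᵥ a) = f := by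
    rw [← hL, ← sum_sum_mul_mul_eq_dotProduct, hr]
    simp only [Finset.mul_sum, ← Finset.sum_add_distrib]
    exact Finset.sum_congr rfl fun i _ => Finset.sum_congr rfl fun j _ => by ring
  have hcrit' : S • a = -(ρ • (H *ᵥ ξ) + c • p) := by
    ext i
    have := hcrit i
    simp only [Pi.smul_apply, smul_eq_mul, Pi.neg_apply, Pi.add_apply]
    linarith
  have e4 : S * (a ⬝ᵥ ξ) = -(ρ * ((H *ᵥ ξ) ⬝ᵥ ξ) + c * (ξ ⬝ᵥ p)) := by
    rw [← smul_eq_mul, ← smul_dotProduct, hcrit', neg_dotProduct, add_dotProduct,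
      smul_dotProduct, smul_dotProduct, dotProduct_comm p]
    rfl
  have e5 : S ^ 2 * (a ⬝ᵥ U *ᵥ a) = ρ ^ 2 * D * ((H *ᵥ ξ) ⬝ᵥ ξ) + 2 * ρ * c * D * (ξ ⬝ᵥ p)
      + c ^ 2 * (p ⬝ᵥ U *ᵥ p) := by
    have : S ^ 2 * (a ⬝ᵥ U *ᵥ a) = (S • a) ⬝ᵥ U *ᵥ (S • a) := by
      simp only [mulVec_smul, smul_dotProduct, dotProduct_smul, smul_eq_mul]; ring
    rw [this, hcrit']
    simp only [mulVec_neg, mulVec_add, mulVec_smul, neg_dotProduct, dotProduct_neg,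
      add_dotProduct, dotProduct_add, smul_dotProduct, dotProduct_smul, smul_eq_mul, hvU, hUHv,
      dotProduct_comm p ξ]
    ring
  have e6 : (n + 1) * ρ ^ n * (r * ρ + n * (a ⬝ᵥ U *ᵥ a)) = f * ρ := by
    rw [← e3]
    rcases n with _ | m
    · simp
    · simp only [Nat.add_sub_cancel]; ring
  have e7 : r * ρ + n * (a ⬝ᵥ U *ᵥ a) = f * ρ * (D * ρ ^ 2) / (n + 1) := by
    have hDn : D * ρ ^ 2 * ρ ^ n = 1 := by rw [← hD]; ring
    rw [eq_div_iff (by positivity), ← e6]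
    linear_combination (-(r * ρ + n * (a ⬝ᵥ U *ᵥ a)) * (n + 1)) * hDn
  have e8 : -(ρ * D * (a ⬝ᵥ ξ)) + ρ * c * D * (ξ ⬝ᵥ p / S) ≤ S * (a ⬝ᵥ U *ᵥ a) := by
    refine le_of_mul_le_mul_left ?_ hS
    have hq : S * (ξ ⬝ᵥ p / S) = ξ ⬝ᵥ p := by field_simp
    have h1 : ρ ^ 2 * D * ((H *ᵥ ξ) ⬝ᵥ ξ) + 2 * ρ * c * D * (ξ ⬝ᵥ p)
        ≤ S * (S * (a ⬝ᵥ U *ᵥ a)) := by nlinarith [mul_nonneg (sq_nonneg c) hBp]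
    refine le_trans (le_of_eq ?_) h1
    linear_combination (-ρ * D) * e4 + (ρ * c * D) * hq
  have hρD : 0 < ρ ^ 2 * D := by positivity
  refine le_of_mul_le_mul_left ?_ hρD
  have e9 : ρ ^ 2 * D * (S * f * ρ / (n + 1) + n + n * c / ρ * (1 - ξ ⬝ᵥ p / S))
      = S * (f * ρ * (D * ρ ^ 2) / (n + 1)) + n * (ρ ^ 2 * D)
        + n * c * ρ * D * (1 - ξ ⬝ᵥ p / S) := by
    field_simp
  rw [e9, ← e7]
  have h1 := mul_nonneg hρ.le e1
  have h2 := mul_le_mul_of_nonneg_left e8 (Nat.cast_nonneg (α := ℝ) n)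
  linear_combination h1 + h2 + ρ * e2

end LinearAlgebra

section PartialDerivatives

open Filter Topology

variable {n : ℕ}

/-- The partial derivative of `f` in the `i`-th coordinate direction. -/
def pd (i : Fin n) (f : E n → ℝ) (x : E n) : ℝ :=
  fderiv ℝ f x (EuclideanSpace.single i 1)

variable {f g : E n → ℝ} {x : E n} (i : Fin n)

theorem pd_add (hf : DifferentiableAt ℝ f x) (hg : DifferentiableAt ℝ g x) :
    pd i (fun y => f y + g y) x = pd i f x + pd i g x := by
  simp [pd, fderiv_fun_add hf hg]

theorem pd_sub (hf : DifferentiableAt ℝ f x) (hg : DifferentiableAt ℝ g x) :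
    pd i (fun y => f y - g y) x = pd i f x - pd i g x := by
  simp [pd, fderiv_fun_sub hf hg]

theorem pd_mul (hf : DifferentiableAt ℝ f x) (hg : DifferentiableAt ℝ g x) :
    pd i (fun y => f y * g y) x = pd i f x * g x + f x * pd i g x := by
  simp [pd, fderiv_fun_mul hf hg]; ring

theorem pd_const_mul (c : ℝ) (hf : DifferentiableAt ℝ f x) :
    pd i (fun y => c * f y) x = c * pd i f x := by
  simp [pd, fderiv_const_mul hf]

theorem pd_pow (m : ℕ) (hf : DifferentiableAt ℝ f x) :
    pd i (fun y => f y ^ m) x = m * f x ^ (m - 1) * pd i f x := by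
  simp [pd, fderiv_fun_pow m hf]

theorem pd_sum {ι : Type*} (s : Finset ι) {F : ι → E n → ℝ}
    (hF : ∀ k ∈ s, DifferentiableAt ℝ (F k) x) :
    pd i (fun y => ∑ k ∈ s, F k y) x = ∑ k ∈ s, pd i (F k) x := by
  simp [pd, fderiv_fun_sum hF]

theorem differentiable_coord (k : Fin n) : Differentiable ℝ (fun y : E n => y k) :=
  (EuclideanSpace.proj k : E n →L[ℝ] ℝ).differentiable

theorem pd_coord (k : Fin n) : pd i (fun y : E n => y k) x = if i = k then 1 else 0 := by
  have : fderiv ℝ (fun y : E n => y k) x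
      = (EuclideanSpace.proj k : E n →L[ℝ] ℝ) :=
    (EuclideanSpace.proj k : E n →L[ℝ] ℝ).fderiv
  rw [pd, this]
  simp [eq_comm]

theorem Filter.EventuallyEq.pd (h : f =ᶠ[𝓝 x] g) : pd i f =ᶠ[𝓝 x] pd i g :=
  (h.fderiv (𝕜 := ℝ)).mono fun y hy => by simp only [_root_.pd, hy]

theorem ContDiffAt.pd {m k : WithTop ℕ∞} (hf : ContDiffAt ℝ m f x) (hk : k + 1 ≤ m) :
    ContDiffAt ℝ k (pd i f) x :=
  (hf.fderiv_right hk).clm_apply contDiffAt_const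

theorem fderiv_fderiv_apply_eq (hf : ContDiffAt ℝ 2 f x) (v w : E n) :
    fderiv ℝ (fun y => fderiv ℝ f y w) x v = fderiv ℝ (fderiv ℝ f) x v w := by
  have h : DifferentiableAt ℝ (fderiv ℝ f) x :=
    (hf.fderiv_right (m := 1) (by norm_num)).differentiableAt (by norm_num)
  rw [fderiv_clm_apply h (differentiableAt_const w)]
  simp

theorem iteratedFDeriv_two_single (hf : ContDiffAt ℝ 2 f x) (j : Fin n) :
    iteratedFDeriv ℝ 2 f x ![EuclideanSpace.single i 1, EuclideanSpace.single j 1]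
      = pd i (pd j f) x := by
  rw [iteratedFDeriv_two_apply]
  exact (fderiv_fderiv_apply_eq hf _ _).symm

theorem pd_comm (hf : ContDiffAt ℝ 2 f x) (j : Fin n) : pd i (pd j f) x = pd j (pd i f) x := by
  have h := (hf.isSymmSndFDerivAt (by simp)).eq
    (EuclideanSpace.single i 1) (EuclideanSpace.single j 1)
  calc pd i (pd j f) x = _ := fderiv_fderiv_apply_eq hf _ _
    _ = _ := h
    _ = _ := (fderiv_fderiv_apply_eq hf _ _).symm

theorem eq_sum_smul_single (v : E n) : v = ∑ i, v i • EuclideanSpace.single i (1 : ℝ) := by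
  ext j
  simp [Pi.single_apply]

theorem clm_apply_eq_sum (L : E n →L[ℝ] ℝ) (v : E n) :
    L v = ∑ i, v i * L (EuclideanSpace.single i 1) := by
  conv_lhs => rw [eq_sum_smul_single v]
  simp

theorem clm_norm_sq_eq_sum (L : E n →L[ℝ] ℝ) :
    ‖L‖ ^ 2 = ∑ i, L (EuclideanSpace.single i 1) ^ 2 := by
  set v := (InnerProductSpace.toDual ℝ (E n)).symm L with hv
  have h1 : ‖L‖ = ‖v‖ := by rw [hv, LinearIsometryEquiv.norm_map]
  rw [h1, EuclideanSpace.norm_sq_eq]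
  refine Finset.sum_congr rfl fun i _ => ?_
  have : L (EuclideanSpace.single i 1) = v i := by
    rw [← InnerProductSpace.toDual_symm_apply (x := EuclideanSpace.single i (1 : ℝ)) (y := L), ← hv,
      EuclideanSpace.inner_single_right]
    simp
  rw [this, Real.norm_eq_abs, sq_abs]

theorem deriv_deriv_nonneg_of_isLocalMin {φ : ℝ → ℝ} {a : ℝ} (h : IsLocalMin φ a)
    (hc : ContinuousAt φ a) : 0 ≤ deriv (deriv φ) a := by
  by_contra! hneg
  have hmax := isLocalMax_of_deriv_deriv_neg hneg h.deriv_eq_zero hc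
  have hconst : φ =ᶠ[𝓝 a] fun _ => φ a := by
    filter_upwards [h, hmax] with t h1 h2 using le_antisymm h2 h1
  have : deriv (deriv φ) a = 0 := by
    rw [hconst.deriv.deriv_eq]
    simp
  exact hneg.ne this

theorem hasDerivAt_comp_line {v : E n} {t : ℝ} (hf : DifferentiableAt ℝ f (x + t • v)) :
    HasDerivAt (fun s : ℝ => f (x + s • v)) (fderiv ℝ f (x + t • v) v) t := by
  have h1 : HasDerivAt (fun s : ℝ => x + s • v) v t := by
    simpa using ((hasDerivAt_id t).smul_const v).const_add x
  exact hf.hasFDerivAt.comp_hasDerivAt t h1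

theorem sum_sum_pd_pd_eq (hf : ContDiffAt ℝ 2 f x) (v : E n) :
    ∑ i, ∑ j, v i * v j * pd i (pd j f) x = fderiv ℝ (fderiv ℝ f) x v v := by
  rw [← fderiv_fderiv_apply_eq hf, clm_apply_eq_sum]
  refine Finset.sum_congr rfl fun i _ => ?_
  rw [fderiv_fderiv_apply_eq hf, clm_apply_eq_sum, Finset.mul_sum]
  refine Finset.sum_congr rfl fun j _ => ?_
  rw [← fderiv_fderiv_apply_eq hf, mul_assoc]
  rfl

theorem sum_pd_pd_nonneg_of_isLocalMin (hf : ContDiffAt ℝ 2 f x) (h : IsLocalMin f x)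
    (v : Fin n → ℝ) : 0 ≤ ∑ i, ∑ j, v i * v j * pd i (pd j f) x := by
  have := sum_sum_pd_pd_eq hf (WithLp.toLp 2 v)
  simp only at this
  rw [this]
  set w : E n := WithLp.toLp 2 v
  have hline : Tendsto (fun s : ℝ => x + s • w) (𝓝 0) (𝓝 x) := by
    have : Continuous fun s : ℝ => x + s • w := by fun_prop
    simpa using this.tendsto 0
  have hmin : IsLocalMin (fun s : ℝ => f (x + s • w)) 0 := by
    have := hline.eventually h
    simpa [IsLocalMin, IsMinFilter] using this
  have hd : deriv (fun s : ℝ => f (x + s • w)) =ᶠ[𝓝 0] fun s => fderiv ℝ f (x + s • w) w := by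
    have h1 : ∀ᶠ y in 𝓝 x, ContDiffAt ℝ 2 f y := hf.eventually (by simp)
    filter_upwards [hline.eventually h1] with s hs
    exact (hasDerivAt_comp_line (hs.differentiableAt (by norm_num))).deriv
  have hdiff : DifferentiableAt ℝ (fun y => fderiv ℝ f y w) (x + (0 : ℝ) • w) := by
    rw [zero_smul, add_zero]
    exact ((hf.fderiv_right (m := 1) (by norm_num)).clm_apply
      contDiffAt_const).differentiableAt (by norm_num)
  have hdd := (hasDerivAt_comp_line hdiff).deriv
  rw [zero_smul, add_zero, fderiv_fderiv_apply_eq hf] at hdd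
  rw [← hdd, ← hd.deriv_eq]
  refine deriv_deriv_nonneg_of_isLocalMin hmin ?_
  have hcx : ContinuousAt f (x + (0 : ℝ) • w) := by
    rw [zero_smul, add_zero]; exact hf.continuousAt
  exact hcx.comp (f := fun s : ℝ => x + s • w) (by fun_prop)

theorem contDiffAt_det {m : WithTop ℕ∞} {M : E n → Matrix (Fin n) (Fin n) ℝ}
    (hM : ∀ i j, ContDiffAt ℝ m (fun y => M y i j) x) :
    ContDiffAt ℝ m (fun y => (M y).det) x := by
  simp only [Matrix.det_apply']
  exact ContDiffAt.sum fun σ _ => contDiffAt_const.mul (contDiffAt_prod fun i _ => hM _ _)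

/-- Jacobi's formula for the derivative of a determinant. -/
theorem pd_det (k : Fin n) {M : E n → Matrix (Fin n) (Fin n) ℝ}
    (hM : ∀ i j, DifferentiableAt ℝ (fun y => M y i j) x) :
    pd k (fun y => (M y).det) x
      = ∑ i, ∑ j, (M x).adjugate j i * pd k (fun y => M y i j) x := by
  let d : ContinuousMultilinearMap ℝ (fun _ : Fin n => Fin n → ℝ) ℝ :=
    ⟨(Matrix.detRowAlternating (R := ℝ) (n := Fin n)).toMultilinearMap,
      by exact continuous_id.matrix_det⟩
  have hrow : ∀ i, HasFDerivAt (fun y => M y i)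
      (ContinuousLinearMap.pi fun j => fderiv ℝ (fun y => M y i j) x) x := fun i =>
    hasFDerivAt_pi.2 fun j => (hM i j).hasFDerivAt
  have h := (HasFDerivAt.multilinear_comp (f := d) hrow).fderiv
  have h2 : pd k (fun y => (M y).det) x = pd k (fun y => d fun i => M y i) x := rfl
  rw [h2, pd, h]
  simp only [sum_apply, ContinuousLinearMap.comp_apply]
  refine Finset.sum_congr rfl fun i _ => ?_
  have h3 : ∀ r : Fin n → ℝ, d.toContinuousLinearMap (fun j => M x j) i r
      = ((M x).updateRow i r).det := fun r => rfl
  rw [h3, Matrix.det_eq_sum_mul_adjugate_row _ i]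
  refine Finset.sum_congr rfl fun j _ => ?_
  rw [mul_comm, Matrix.updateRow_self, Matrix.adjugate_apply, Matrix.adjugate_apply]
  simp [pd]

end PartialDerivatives

section MaximumPrinciple

open Filter Topology Matrix

variable {n : ℕ} {f g u : E n → ℝ} {x y : E n} {ε c : ℝ}

theorem ContDiffAt.eventually_two {m : ℕ} (hm : 2 ≤ m) (hf : ContDiffAt ℝ m f x) :
    ∀ᶠ z in 𝓝 x, ContDiffAt ℝ 2 f z :=
  (hf.of_le (by exact_mod_cast hm)).eventually (by simp)

theorem ContDiffAt.differentiableAt_pd (hf : ContDiffAt ℝ 2 f x) (i : Fin n) :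
    DifferentiableAt ℝ (_root_.pd i f) x :=
  (hf.pd (k := 1) i (by norm_num)).differentiableAt (by norm_num)

theorem pd_pd_mul (i j : Fin n) (hf : ContDiffAt ℝ 2 f x) (hg : ContDiffAt ℝ 2 g x) :
    pd i (pd j fun z => f z * g z) x
      = pd i (pd j f) x * g x + pd j f x * pd i g x + (pd i f x * pd j g x
        + f x * pd i (pd j g) x) := by
  have hf1 := hf.differentiableAt (by norm_num)
  have hg1 := hg.differentiableAt (by norm_num)
  have hj : pd j (fun z => f z * g z) =ᶠ[𝓝 x] fun z => pd j f z * g z + f z * pd j g z := by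
    filter_upwards [hf.eventually_two le_rfl, hg.eventually_two le_rfl] with z h1 h2
    exact pd_mul j (h1.differentiableAt (by norm_num)) (h2.differentiableAt (by norm_num))
  rw [(hj.pd i).eq_of_nhds, pd_add i ((hf.differentiableAt_pd j).fun_mul hg1)
    (hf1.fun_mul (hg.differentiableAt_pd j)), pd_mul i (hf.differentiableAt_pd j) hg1,
    pd_mul i hf1 (hg.differentiableAt_pd j)]

theorem pd_pd_pow (i j : Fin n) (m : ℕ) (hf : ContDiffAt ℝ 2 f x) :
    pd i (pd j fun z => f z ^ (m + 1)) x
      = (m + 1) * f x ^ m * pd i (pd j f) x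
        + m * (m + 1) * f x ^ (m - 1) * (pd i f x * pd j f x) := by
  have hf1 := hf.differentiableAt (by norm_num)
  have hj : pd j (fun z => f z ^ (m + 1))
      =ᶠ[𝓝 x] fun z => ((m + 1 : ℕ) : ℝ) * (f z ^ m * pd j f z) := by
    filter_upwards [hf.eventually_two le_rfl] with z h1
    rw [pd_pow j (m + 1) (h1.differentiableAt (by norm_num)), Nat.add_sub_cancel, mul_assoc]
  rw [(hj.pd i).eq_of_nhds, pd_const_mul i _ ((hf1.fun_pow m).fun_mul (hf.differentiableAt_pd j)),
    pd_mul i (hf1.fun_pow m) (hf.differentiableAt_pd j), pd_pow i m hf1]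
  push_cast
  ring

theorem hess_apply (hu : ContDiffAt ℝ 2 u x) (i j : Fin n) :
    Hess u x i j = pd i (pd j u) x :=
  iteratedFDeriv_two_single i hu j

/-- The Legendre-type quantity `x · Du - u - ε |Du|²`. -/
def legendreAux (ε : ℝ) (u : E n → ℝ) (x : E n) : ℝ :=
  ∑ k, x k * pd k u x - u x - ε * ∑ k, pd k u x ^ 2

theorem legendreAux_eq (ε : ℝ) (u : E n → ℝ) (x : E n) :
    legendreAux ε u x = fderiv ℝ u x x - u x - ε * ‖fderiv ℝ u x‖ ^ 2 := by
  rw [legendreAux, clm_norm_sq_eq_sum, clm_apply_eq_sum (fderiv ℝ u x) x]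
  rfl

theorem ContDiffAt.legendreAux {m k : WithTop ℕ∞} (hu : ContDiffAt ℝ m u x) (hk : k + 1 ≤ m) :
    ContDiffAt ℝ k (legendreAux ε u) x := by
  have hp := fun i => hu.pd i hk
  have hu' : ContDiffAt ℝ k u x := hu.of_le (le_self_add.trans hk)
  have hx : ∀ i, ContDiffAt ℝ k (fun z : E n => z i) x := fun i =>
    (EuclideanSpace.proj i : E n →L[ℝ] ℝ).contDiff.contDiffAt
  exact ((ContDiffAt.sum fun i _ => (hx i).mul (hp i)).sub hu').sub
    (contDiffAt_const.mul (ContDiffAt.sum fun i _ => (hp i).pow 2))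

theorem pd_legendreAux (j : Fin n) (hu : ContDiffAt ℝ 2 u x) :
    pd j (legendreAux ε u) x = ∑ k, (x k - 2 * ε * pd k u x) * pd j (pd k u) x := by
  have hu1 := hu.differentiableAt (by norm_num)
  have hp := fun k => hu.differentiableAt_pd k
  have hx := fun k => (differentiable_coord k).differentiableAt (x := x)
  have h1 : ∀ k ∈ (Finset.univ : Finset (Fin n)),
      DifferentiableAt ℝ (fun z => z k * pd k u z) x := fun k _ => (hx k).fun_mul (hp k)
  have h2 : ∀ k ∈ (Finset.univ : Finset (Fin n)),
      DifferentiableAt ℝ (fun z => pd k u z ^ 2) x := fun k _ => (hp k).fun_pow 2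
  have h3 := DifferentiableAt.fun_sum h1
  have h4 := DifferentiableAt.fun_sum h2
  change pd j (fun z => ∑ k, z k * pd k u z - u z - ε * ∑ k, pd k u z ^ 2) x = _
  rw [pd_sub j (h3.fun_sub hu1) (h4.const_mul ε), pd_sub j h3 hu1, pd_const_mul j ε h4,
    pd_sum j _ h1, pd_sum j _ h2]
  simp_rw [pd_mul j (hx _) (hp _), pd_pow j 2 (hp _), pd_coord]
  simp only [sub_mul, Finset.sum_add_distrib, Finset.sum_sub_distrib, Finset.mul_sum, ite_mul,
    one_mul, zero_mul, Finset.sum_ite_eq, Finset.mem_univ, if_true]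
  have : ∀ k, ε * (((2 : ℕ) : ℝ) * pd k u x ^ (2 - 1) * pd j (pd k u) x)
      = 2 * ε * pd k u x * pd j (pd k u) x := fun k => by push_cast; ring
  simp_rw [this]
  ring

theorem pd_pd_legendreAux (i j : Fin n) (hu : ContDiffAt ℝ 3 u x) :
    pd i (pd j (legendreAux ε u)) x
      = pd i (pd j u) x - 2 * ε * ∑ k, pd i (pd k u) x * pd k (pd j u) x
        + ∑ k, (x k - 2 * ε * pd k u x) * pd k (pd i (pd j u)) x := by
  have hu2 : ContDiffAt ℝ 2 u x := hu.of_le (by norm_num)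
  have hj : pd j (legendreAux ε u)
      =ᶠ[𝓝 x] fun z => ∑ k, (z k - 2 * ε * pd k u z) * pd k (pd j u) z := by
    filter_upwards [ContDiffAt.eventually_two (m := 3) (by norm_num) hu] with z hz
    rw [pd_legendreAux j hz]
    exact Finset.sum_congr rfl fun k _ => by rw [pd_comm j hz k]
  have hp2 := fun k => hu.pd (k := 2) k (by norm_num)
  have hp := fun k => hu2.differentiableAt_pd k
  have hpp := fun k => (hp2 j).differentiableAt_pd k
  have hx := fun k => (differentiable_coord k).differentiableAt (x := x)
  have hξ := fun k => (hx k).fun_sub ((hp k).const_mul (2 * ε))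
  rw [(hj.pd i).eq_of_nhds, pd_sum i _ fun k _ => (hξ k).fun_mul (hpp k)]
  simp_rw [pd_mul i (hξ _) (hpp _), pd_sub i (hx _) ((hp _).const_mul (2 * ε)),
    pd_const_mul i (2 * ε) (hp _), pd_coord, pd_comm i (hp2 j)]
  simp only [sub_mul, Finset.sum_add_distrib, Finset.sum_sub_distrib, Finset.mul_sum, ite_mul,
    one_mul, zero_mul, Finset.sum_ite_eq, Finset.mem_univ, if_true, mul_assoc]

/-- The power `(det D²u)^(-1/(n+2))` of the Hessian determinant. -/
def hessRoot (u : E n → ℝ) (x : E n) : ℝ :=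
  (Hess u x).det ^ (-1 / (n + 2 : ℝ))

theorem hessRoot_pos (h : (Hess u x).PosDef) : 0 < hessRoot u x :=
  Real.rpow_pos_of_pos h.det_pos _

theorem det_mul_hessRoot_pow (h : (Hess u x).PosDef) :
    (Hess u x).det * hessRoot u x ^ (n + 2) = 1 := by
  have hd := h.det_pos
  have hn : (n + 2 : ℝ) ≠ 0 := by positivity
  rw [hessRoot, ← Real.rpow_natCast, ← Real.rpow_mul hd.le]
  push_cast
  rw [div_mul_cancel₀ _ hn, Real.rpow_neg_one, mul_inv_cancel₀ hd.ne']

theorem wFn_eq_hessRoot_pow (h : (Hess u x).PosDef) : wFn n u x = hessRoot u x ^ (n + 1) := by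
  rw [wFn, hessRoot, ← Real.rpow_natCast, ← Real.rpow_mul h.det_pos.le]
  congr 1
  push_cast
  ring

theorem contDiffAt_hess (hu : ContDiffAt ℝ 4 u x) (i j : Fin n) :
    ContDiffAt ℝ 2 (fun z => Hess u z i j) x := by
  have h : (fun z => Hess u z i j) =ᶠ[𝓝 x] pd i (pd j u) := by
    filter_upwards [ContDiffAt.eventually_two (m := 4) (by norm_num) hu] with z hz
      using hess_apply hz i j
  exact ((hu.pd (k := 3) j (by norm_num)).pd i (by norm_num)).congr_of_eventuallyEq h

theorem contDiffAt_hessRoot (hu : ContDiffAt ℝ 4 u x) (h : (Hess u x).PosDef) :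
    ContDiffAt ℝ 2 (hessRoot u) x :=
  (contDiffAt_det (contDiffAt_hess hu)).rpow_const_of_ne h.det_pos.ne'

theorem trace_hess_le_of_isLocalMin (hu : ContDiffAt ℝ 4 u y)
    (hpos : ∀ᶠ z in 𝓝 y, (Hess u z).PosDef) (hS : 0 < legendreAux ε u y)
    (hmin : IsLocalMin (fun z => hessRoot u z * legendreAux ε u z + c * u z) y) :
    2 * ε * (Hess u y).trace ≤ legendreAux ε u y * Lop n u y * hessRoot u y / (n + 1) + n
      + n * c / hessRoot u y
        * (1 - (∑ k, (y k - 2 * ε * pd k u y) * pd k u y) / legendreAux ε u y) := by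
  have hposy := hpos.self_of_nhds
  have hu2 : ContDiffAt ℝ 2 u y := hu.of_le (by norm_num)
  have hu3 : ContDiffAt ℝ 3 u y := hu.of_le (by norm_num)
  have hρ := contDiffAt_hessRoot hu hposy
  have hρ1 := hρ.differentiableAt (by norm_num)
  have hSd : ContDiffAt ℝ 2 (legendreAux ε u) y := hu3.legendreAux (by norm_num)
  have hS1 := hSd.differentiableAt (by norm_num)
  have hu1 := hu2.differentiableAt (by norm_num)
  have hHess : ∀ i j, (fun z => Hess u z i j) =ᶠ[𝓝 y] pd i (pd j u) := fun i j => by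
    filter_upwards [ContDiffAt.eventually_two (m := 4) (by norm_num) hu] with z hz
      using hess_apply hz i j
  have hHd := fun i j => (contDiffAt_hess hu i j).differentiableAt (by norm_num)
  have hgd : ContDiffAt ℝ 2 (fun z => hessRoot u z * legendreAux ε u z + c * u z) y :=
    (hρ.mul hSd).add (contDiffAt_const.mul hu2)
  have hpdS : ∀ j, pd j (legendreAux ε u) y
      = (Hess u y *ᵥ fun k => y k - 2 * ε * pd k u y) j := fun j => by
    rw [pd_legendreAux j hu2, mulVec, dotProduct]
    exact Finset.sum_congr rfl fun k _ => by rw [hess_apply hu2, mul_comm]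
  refine trace_le_of_critical (H := Hess u y)
    (R := fun i j => pd i (pd j (hessRoot u)) y)
    (G := fun i j => pd i (pd j fun z => hessRoot u z * legendreAux ε u z + c * u z) y)
    (T := fun k i j => pd k (pd i (pd j u)) y) (a := fun i => pd i (hessRoot u) y)
    (ξ := fun k => y k - 2 * ε * pd k u y) (p := fun k => pd k u y)
    hposy hS (hessRoot_pos hposy) (det_mul_hessRoot_pow hposy) ?_ ?_ ?_ ?_ ?_
  · intro i j
    have hj : pd j (fun z => hessRoot u z * legendreAux ε u z + c * u z) =ᶠ[𝓝 y]
        fun z => pd j (fun z => hessRoot u z * legendreAux ε u z) z + c * pd j u z := by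
      filter_upwards [(hρ.mul hSd).eventually_two (m := 2) le_rfl,
        hu2.eventually_two (m := 2) le_rfl] with z h1 h2
      rw [← pd_const_mul j c (h2.differentiableAt (by norm_num))]
      exact pd_add j (h1.differentiableAt (by norm_num))
        ((h2.differentiableAt (by norm_num)).const_mul c)
    rw [(hj.pd i).eq_of_nhds, pd_add i ((hρ.mul hSd).differentiableAt_pd j)
      ((hu2.differentiableAt_pd j).const_mul c), pd_const_mul i c (hu2.differentiableAt_pd j),
      pd_pd_mul i j hρ hSd, pd_pd_legendreAux i j hu3, hpdS, hpdS, mul_apply]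
    simp only [hess_apply hu2]
    ring
  · exact sum_mul_nonneg_of_posSemidef (posSemidef_adjugate hposy)
      (sum_pd_pd_nonneg_of_isLocalMin hgd hmin)
  · intro i
    have h0 : pd i (fun z => hessRoot u z * legendreAux ε u z + c * u z) y = 0 := by
      rw [pd, hmin.fderiv_eq_zero]; rfl
    rw [pd_add i (hρ1.fun_mul hS1) (hu1.const_mul c), pd_mul i hρ1 hS1, pd_const_mul i c hu1,
      hpdS] at h0
    linarith
  · intro k
    have hdet := (contDiffAt_det (contDiffAt_hess hu)).differentiableAt (by norm_num)
    have h1 : (fun z => (Hess u z).det * hessRoot u z ^ (n + 2)) =ᶠ[𝓝 y] fun _ => 1 := by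
      filter_upwards [hpos] with z hz using det_mul_hessRoot_pow hz
    have h2 := (h1.pd k).eq_of_nhds
    rw [pd_mul k hdet (hρ1.fun_pow _), pd_pow k _ hρ1, pd_det k hHd] at h2
    have h3 : pd k (fun _ : E n => (1 : ℝ)) y = 0 := by simp [pd]
    have h4 : ∑ i, ∑ j, (Hess u y).adjugate j i * pd k (fun z => Hess u z i j) y
        = ∑ i, ∑ j, (Hess u y).adjugate i j * pd k (pd i (pd j u)) y := by
      rw [Finset.sum_comm]
      refine Finset.sum_congr rfl fun i _ => Finset.sum_congr rfl fun j _ => ?_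
      have : (fun z => Hess u z j i) =ᶠ[𝓝 y] pd i (pd j u) := by
        filter_upwards [ContDiffAt.eventually_two (m := 4) (by norm_num) hu] with z hz
        rw [hess_apply hz, pd_comm j hz]
      rw [(this.pd k).eq_of_nhds]
    rw [h3, h4] at h2
    have h5 : hessRoot u y ^ (n + 1) ≠ 0 := (pow_pos (hessRoot_pos hposy) _).ne'
    refine mul_left_cancel₀ h5 ?_
    rw [mul_zero, ← h2, show n + 2 - 1 = n + 1 from rfl]
    push_cast
    ring
  · have hw : wFn n u =ᶠ[𝓝 y] fun z => hessRoot u z ^ (n + 1) := by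
      filter_upwards [hpos] with z hz using wFn_eq_hessRoot_pow hz
    have hwd : ContDiffAt ℝ 2 (wFn n u) y := (hρ.pow (n + 1)).congr_of_eventuallyEq hw
    refine Finset.sum_congr rfl fun i _ => Finset.sum_congr rfl fun j _ => ?_
    rw [iteratedFDeriv_two_single i hwd, ((hw.pd j).pd i).eq_of_nhds, pd_pd_pow i j n hρ]

end MaximumPrinciple

section ConvexGeometry

open Filter Topology

variable {n : ℕ} {u : E n → ℝ} {Ω : Set (E n)} {x y : E n}

theorem fderiv_fderiv_nonneg_of_posDef (hu : ContDiffAt ℝ 2 u x) (h : (Hess u x).PosDef)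
    (v : E n) : 0 ≤ fderiv ℝ (fderiv ℝ u) x v v := by
  rw [← sum_sum_pd_pd_eq hu v]
  have := h.posSemidef.dotProduct_mulVec_nonneg (fun i => v i)
  simp only [dotProduct, Matrix.mulVec, star_trivial, Finset.mul_sum] at this
  refine this.trans_eq (Finset.sum_congr rfl fun i _ => Finset.sum_congr rfl fun j _ => ?_)
  rw [hess_apply hu]
  ring

theorem add_fderiv_le_of_posDef (hΩ : IsOpen Ω) (hconv : Convex ℝ Ω) (hu : ContDiffOn ℝ 4 u Ω)
    (hpos : ∀ z ∈ Ω, (Hess u z).PosDef) (hx : x ∈ Ω) (hy : y ∈ Ω) :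
    u x + fderiv ℝ u x (y - x) ≤ u y := by
  have hat : ∀ z ∈ Ω, ContDiffAt ℝ 2 u z := fun z hz =>
    (hu.contDiffAt (hΩ.mem_nhds hz)).of_le (by norm_num)
  set v := y - x with hv
  have hmem : ∀ t ∈ Set.Icc (0 : ℝ) 1, x + t • v ∈ Ω := fun t ht =>
    hconv.add_smul_sub_mem hx hy ht
  have hd1 : ∀ t ∈ Set.Icc (0 : ℝ) 1,
      HasDerivAt (fun s : ℝ => u (x + s • v)) (fderiv ℝ u (x + t • v) v) t := fun t ht =>
    hasDerivAt_comp_line ((hat _ (hmem t ht)).differentiableAt (by norm_num))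
  have hd2 : ∀ t ∈ interior (Set.Icc (0 : ℝ) 1),
      HasDerivAt (deriv fun s : ℝ => u (x + s • v))
        (fderiv ℝ (fderiv ℝ u) (x + t • v) v v) t := fun t ht => by
    have hc := hat _ (hmem t (interior_subset ht))
    have hdiff : DifferentiableAt ℝ (fun z => fderiv ℝ u z v) (x + t • v) :=
      ((hc.fderiv_right (m := 1) (by norm_num)).clm_apply
        contDiffAt_const).differentiableAt (by norm_num)
    have := hasDerivAt_comp_line hdiff
    rw [fderiv_fderiv_apply_eq hc] at this
    refine this.congr_of_eventuallyEq ?_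
    filter_upwards [isOpen_interior.mem_nhds ht] with s hs
    exact (hd1 s (interior_subset hs)).deriv
  have hcvx : ConvexOn ℝ (Set.Icc (0 : ℝ) 1) fun s : ℝ => u (x + s • v) := by
    refine convexOn_of_deriv2_nonneg (convex_Icc 0 1)
      (fun t ht => (hd1 t ht).continuousAt.continuousWithinAt)
      (fun t ht => (hd1 t (interior_subset ht)).differentiableAt.differentiableWithinAt)
      (fun t ht => (hd2 t ht).differentiableAt.differentiableWithinAt) fun t ht => ?_
    rw [Function.iterate_succ, Function.iterate_one, Function.comp_apply, (hd2 t ht).deriv]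
    have hm := hmem t (interior_subset ht)
    exact fderiv_fderiv_nonneg_of_posDef (hat _ hm) (hpos _ hm) v
  have h0 : (0 : ℝ) ∈ Set.Icc (0 : ℝ) 1 := by simp
  have h := hcvx.le_slope_of_hasDerivAt h0 (by simp : (1 : ℝ) ∈ Set.Icc (0 : ℝ) 1) one_pos
    (hd1 0 h0)
  simp only [slope, zero_smul, add_zero, one_smul, sub_zero, inv_one, vsub_eq_sub, hv,
    add_sub_cancel] at h
  linarith

theorem neg_of_posDef_of_frontier_eq_zero (hn : 0 < n) (hΩ : IsOpen Ω)
    (hbdd : Bornology.IsBounded Ω) (hu : ContDiffOn ℝ 4 u Ω) (hcont : ContinuousOn u (closure Ω))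
    (hpos : ∀ z ∈ Ω, (Hess u z).PosDef) (hbd : ∀ z ∈ frontier Ω, u z = 0) (hx : x ∈ Ω) :
    u x < 0 := by
  have hnotmax : ∀ z ∈ Ω, ¬ IsMaxOn u (closure Ω) z := fun z hz hmax => by
    have hu2 : ContDiffAt ℝ 2 u z := (hu.contDiffAt (hΩ.mem_nhds hz)).of_le (by norm_num)
    have hmin : IsLocalMin (fun y => (-1) * u y) z := by
      filter_upwards [hΩ.mem_nhds hz] with y hy
      have := (hmax (subset_closure hy)).out
      linarith
    have h := sum_pd_pd_nonneg_of_isLocalMin (contDiffAt_const.mul hu2) hmin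
      (Pi.single ⟨0, hn⟩ 1)
    simp only [Pi.single_apply, ite_mul, mul_ite, one_mul, mul_one, mul_zero, zero_mul,
      Finset.sum_ite_eq', Finset.mem_univ, if_true] at h
    have hp := (hpos z hz).diag_pos (i := ⟨0, hn⟩)
    rw [hess_apply hu2] at hp
    have he : pd ⟨0, hn⟩ (fun y => (-1) * u y) =ᶠ[𝓝 z] fun y => (-1) * pd ⟨0, hn⟩ u y := by
      filter_upwards [hu2.eventually_two (m := 2) le_rfl] with y hy
      exact pd_const_mul _ _ (hy.differentiableAt (by norm_num))
    rw [(he.pd _).eq_of_nhds, pd_const_mul _ _ (hu2.differentiableAt_pd _)] at h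
    linarith
  by_contra! hux
  obtain ⟨z, hz, hzmax⟩ := (hbdd.isCompact_closure).exists_isMaxOn ⟨x, subset_closure hx⟩ hcont
  by_cases hzΩ : z ∈ Ω
  · exact hnotmax z hzΩ hzmax
  · have hz0 : u z = 0 := hbd z (by rw [hΩ.frontier_eq]; exact ⟨hz, hzΩ⟩)
    refine hnotmax x hx fun y hy => ?_
    exact ((hzmax hy).out.trans hz0.le).trans hux

theorem norm_mul_le_of_forall_apply_le {L : E n →L[ℝ] ℝ} {r M : ℝ} (hr : 0 ≤ r)
    (h : ∀ v, ‖v‖ ≤ r → L v ≤ M) : ‖L‖ * r ≤ M := by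
  set w := (InnerProductSpace.toDual ℝ (E n)).symm L with hw
  have hLw : ‖L‖ = ‖w‖ := by rw [hw, LinearIsometryEquiv.norm_map]
  rcases eq_or_ne w 0 with h0 | h0
  · rw [hLw, h0, norm_zero, zero_mul]
    simpa using h 0 (by simpa using hr)
  · have hw0 : 0 < ‖w‖ := norm_pos_iff.2 h0
    have h1 := h ((r / ‖w‖) • w) (by
      rw [norm_smul, Real.norm_of_nonneg (by positivity), div_mul_cancel₀ _ hw0.ne'])
    have h2 : L w = ‖w‖ ^ 2 := by
      rw [← InnerProductSpace.toDual_symm_apply (x := w) (y := L), ← hw, real_inner_self_eq_norm_sq]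
    rw [map_smul, h2, smul_eq_mul] at h1
    rw [hLw]
    calc ‖w‖ * r = r / ‖w‖ * ‖w‖ ^ 2 := by field_simp
      _ ≤ M := h1

theorem ball_subset_of_le_infDist_frontier {δ : ℝ} (hΩ : IsOpen Ω) (hδ : 0 < δ) (hx : x ∈ Ω)
    (h : δ ≤ Metric.infDist x (frontier Ω)) : Metric.ball x δ ⊆ Ω := by
  refine (convex_ball x δ).isPreconnected.subset_of_closure_inter_subset hΩ
    ⟨x, Metric.mem_ball_self hδ, hx⟩ fun z hz => ?_
  by_contra hzΩ
  have hzf : z ∈ frontier Ω := by rw [hΩ.frontier_eq]; exact ⟨hz.1, hzΩ⟩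
  have h1 := Metric.infDist_le_dist_of_mem (x := x) hzf
  have h2 := Metric.mem_ball'.1 hz.2
  linarith

theorem norm_fderiv_div_le (hn : 0 < n) (hΩ : IsOpen Ω) (hconv : Convex ℝ Ω)
    (hin : Metric.ball (0 : E n) (1 / n) ⊆ Ω) (hu : ContDiffOn ℝ 4 u Ω)
    (hpos : ∀ z ∈ Ω, (Hess u z).PosDef) (hneg : ∀ z ∈ Ω, u z < 0) (hx : x ∈ Ω) :
    ‖fderiv ℝ u x‖ * (1 / (2 * n)) ≤ fderiv ℝ u x x - u x := by
  have hn' : (0 : ℝ) < n := by exact_mod_cast hn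
  refine norm_mul_le_of_forall_apply_le (by positivity) fun v hv => ?_
  have hvΩ : v ∈ Ω := hin (by
    rw [mem_ball_zero_iff]
    refine hv.trans_lt ?_
    rw [div_lt_div_iff₀ (by positivity) hn']
    linarith)
  have h := add_fderiv_le_of_posDef hΩ hconv hu hpos hx hvΩ
  rw [map_sub] at h
  linarith [hneg v hvΩ]

theorem legendreAux_bounds {K₁ K₃ : ℝ} (hn : 0 < n) (hΩ : IsOpen Ω) (hconv : Convex ℝ Ω)
    (hin : Metric.ball (0 : E n) (1 / n) ⊆ Ω) (hout : Ω ⊆ Metric.ball (0 : E n) 1)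
    (hu : ContDiffOn ℝ 4 u Ω) (hpos : ∀ z ∈ Ω, (Hess u z).PosDef) (hneg : ∀ z ∈ Ω, u z < 0)
    (hK₁ : 0 < K₁) (hgrad : ∀ z ∈ Ω, ‖fderiv ℝ u z‖ ≤ K₁) (hsup : ∀ z ∈ Ω, |u z| ≤ K₃)
    (hx : x ∈ Ω) :
    0 < legendreAux (1 / (4 * n * K₁)) u x ∧ legendreAux (1 / (4 * n * K₁)) u x ≤ K₁ + K₃ ∧
      legendreAux (1 / (4 * n * K₁)) u x ≤ ‖fderiv ℝ u x‖ - u x ∧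
      -u x + 1 / (4 * n * K₁) * ‖fderiv ℝ u x‖ ^ 2
        ≤ (4 * n + 3) * legendreAux (1 / (4 * n * K₁)) u x := by
  have hn' : (0 : ℝ) < n := by exact_mod_cast hn
  have hV := norm_fderiv_div_le hn hΩ hconv hin hu hpos hneg hx
  have hux := hneg x hx
  have hP := hgrad x hx
  have hK₃ := hsup x hx
  rw [abs_of_neg hux] at hK₃
  have hx1 : ‖x‖ ≤ 1 := (mem_ball_zero_iff.1 (hout hx)).le
  have habs : |fderiv ℝ u x x| ≤ ‖fderiv ℝ u x‖ := by
    rw [← Real.norm_eq_abs]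
    exact ((fderiv ℝ u x).le_opNorm x).trans (mul_le_of_le_one_right (norm_nonneg _) hx1)
  obtain ⟨habs1, habs2⟩ := abs_le.1 habs
  rw [legendreAux_eq]
  set P := ‖fderiv ℝ u x‖ with hPdef
  set V := fderiv ℝ u x x - u x with hVdef
  have hP0 : 0 ≤ P := norm_nonneg _
  have hPV : P ≤ 2 * n * V := by
    have := mul_le_mul_of_nonneg_left hV (by positivity : (0 : ℝ) ≤ 2 * n)
    have h2 : 2 * n * (P * (1 / (2 * n))) = P := by field_simp
    linarith
  have hεP : 1 / (4 * n * K₁) * P ^ 2 ≤ V / 2 := by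
    rw [div_mul_eq_mul_div, one_mul, div_le_iff₀ (by positivity)]
    nlinarith [mul_le_mul hP hPV hP0 hK₁.le]
  have hεP0 : 0 ≤ 1 / (4 * n * K₁) * P ^ 2 := by positivity
  have huV : -u x ≤ (2 * n + 1) * V := by linarith
  have hV0 : 0 < V := pos_of_mul_pos_right (a := 2 * (n : ℝ) + 1) (by linarith) (by positivity)
  refine ⟨by linarith, by linarith, by linarith, ?_⟩
  nlinarith

end ConvexGeometry

section InteriorEstimate

open Filter Topology

variable {n : ℕ} {u : E n → ℝ} {Ω : Set (E n)} {x : E n}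

theorem mul_le_of_trace_bound {D t ρ r A B N e : ℝ} (he : 0 < e) (hρ : 0 < ρ) (hr : 0 < r)
    (hrN : r ≤ N) (hN : 1 ≤ N) (hA : 0 ≤ A) (hB : 0 ≤ B) (ht : 0 ≤ t) (hD : D * ρ ^ (n + 2) = 1)
    (hDt : D ≤ t ^ n) (hbound : e * t ≤ A * ρ + B / r) :
    1 / (1 + ((A * N ^ 2 + B) / e) ^ n * N ^ 2) * r ≤ ρ := by
  set Q := (A * N ^ 2 + B) / e with hQ
  set κ := 1 / (1 + Q ^ n * N ^ 2) with hκ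
  have hQ0 : 0 ≤ Q := by positivity
  have hκ0 : 0 < κ := by positivity
  have hκ1 : κ ≤ 1 := by
    rw [hκ, div_le_one (by positivity)]
    have : 0 ≤ Q ^ n * N ^ 2 := by positivity
    linarith
  by_contra! hlt
  have hρr : ρ ≤ r := hlt.le.trans (mul_le_of_le_one_left hr.le hκ1)
  have htQ : t ≤ Q / r := by
    rw [hQ, div_div, le_div_iff₀ (by positivity)]
    have h1 : e * t * r ≤ (A * ρ + B / r) * r := mul_le_mul_of_nonneg_right hbound hr.le
    have h2 : (A * ρ + B / r) * r = A * (ρ * r) + B := by field_simp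
    have h3 : ρ * r ≤ N ^ 2 := by nlinarith
    have h4 := mul_le_mul_of_nonneg_left h3 hA
    linarith
  have h1 : (1 : ℝ) ≤ (Q / r) ^ n * (κ * r) ^ (n + 2) := by
    rw [← hD]
    have h2 : D ≤ (Q / r) ^ n := hDt.trans (pow_le_pow_left₀ ht htQ n)
    have h3 : ρ ^ (n + 2) ≤ (κ * r) ^ (n + 2) := pow_le_pow_left₀ hρ.le hlt.le _
    exact mul_le_mul h2 h3 (by positivity) (by positivity)
  have h2 : (Q / r) ^ n * (κ * r) ^ (n + 2) = Q ^ n * r ^ 2 * κ ^ (n + 2) := by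
    rw [div_pow, mul_pow, pow_add r]
    field_simp
  have h3 : κ ^ (n + 2) ≤ κ := by
    simpa using pow_le_pow_of_le_one hκ0.le hκ1 (show 1 ≤ n + 2 by omega)
  have h4 : Q ^ n * r ^ 2 * κ ^ (n + 2) ≤ Q ^ n * N ^ 2 * κ :=
    mul_le_mul (mul_le_mul_of_nonneg_left (pow_le_pow_left₀ hr.le hrN 2) (by positivity)) h3
      (by positivity) (by positivity)
  have h5 : Q ^ n * N ^ 2 * κ + κ = 1 := by
    rw [hκ]
    field_simp
    ring
  linarith

theorem exists_isLocalMin_of_sublevel {S ρ : E n → ℝ} {τ : ℝ} (hΩ : IsOpen Ω)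
    (hbdd : Bornology.IsBounded Ω) (hcont : ContinuousOn u (closure Ω))
    (hbd : ∀ z ∈ frontier Ω, u z = 0) (hτ : 0 < τ) (hx : x ∈ Ω) (hxτ : u x < -τ)
    (hS : ContinuousOn S Ω) (hρ : ContinuousOn ρ Ω) (hS0 : ∀ z ∈ Ω, 0 < S z)
    (hρ0 : ∀ z ∈ Ω, 0 < ρ z) :
    ∃ y ∈ Ω, u y < -τ ∧ IsLocalMin (fun z => ρ z * S z + ρ y * S y / (-u y - τ) * u z) y ∧
      (-u x - τ) / (ρ x * S x) ≤ (-u y - τ) / (ρ y * S y) := by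
  set K := closure Ω ∩ u ⁻¹' Set.Iic (-τ) with hK
  have hKΩ : K ⊆ Ω := fun z hz => by
    by_contra hzΩ
    have h0 := hbd z (by rw [hΩ.frontier_eq]; exact ⟨hz.1, hzΩ⟩)
    have h1 : u z ≤ -τ := hz.2
    linarith
  have hKc : IsCompact K := hbdd.isCompact_closure.of_isClosed_subset
    (hcont.preimage_isClosed_of_isClosed isClosed_closure isClosed_Iic) Set.inter_subset_left
  have hP : ∀ z ∈ Ω, 0 < ρ z * S z := fun z hz => mul_pos (hρ0 z hz) (hS0 z hz)
  have hM : ContinuousOn (fun z => (-u z - τ) / (ρ z * S z)) K :=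
    ((hcont.mono Set.inter_subset_left).neg.sub continuousOn_const).div
      ((hρ.mul hS).mono hKΩ) fun z hz => (hP z (hKΩ hz)).ne'
  have hxK : x ∈ K := ⟨subset_closure hx, hxτ.le⟩
  obtain ⟨y, hyK, hmax⟩ := hKc.exists_isMaxOn ⟨x, hxK⟩ hM
  have hyΩ := hKΩ hyK
  have hMx : 0 < (-u x - τ) / (ρ x * S x) := div_pos (by linarith) (hP x hx)
  have hxy : (-u x - τ) / (ρ x * S x) ≤ (-u y - τ) / (ρ y * S y) := (hmax hxK).out
  have hη : 0 < -u y - τ := by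
    have := mul_pos (hMx.trans_le hxy) (hP y hyΩ)
    rwa [div_mul_cancel₀ _ (hP y hyΩ).ne'] at this
  refine ⟨y, hyΩ, by linarith, ?_, hxy⟩
  set c := ρ y * S y / (-u y - τ) with hc
  have hc0 : 0 < c := div_pos (hP y hyΩ) hη
  have hcy : c * (-u y - τ) = ρ y * S y := div_mul_cancel₀ _ hη.ne'
  filter_upwards [hΩ.mem_nhds hyΩ] with z hz
  have hPz := hP z hz
  rcases le_or_gt (u z) (-τ) with h | h
  · have h1 : (-u z - τ) / (ρ z * S z) ≤ (-u y - τ) / (ρ y * S y) :=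
      (hmax ⟨subset_closure hz, h⟩).out
    rw [div_le_div_iff₀ hPz (hP y hyΩ), ← hcy] at h1
    have h2 : c * (-u z - τ) ≤ ρ z * S z := by
      refine le_of_mul_le_mul_right ?_ hη
      linarith
    linarith
  · have := mul_pos hc0 (by linarith : 0 < u z + τ)
    linarith

theorem mul_le_hessRoot_of_isLocalMin {K₁ K₂ K₃ τ : ℝ} {y : E n} (hn : 0 < n) (hK₁ : 0 < K₁)
    (hK₂ : 0 < K₂) (hK₃ : 0 < K₃) (hu : ContDiffAt ℝ 4 u y)
    (hpos : ∀ᶠ z in 𝓝 y, (Hess u z).PosDef) (hL : Lop n u y ≤ K₂)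
    (hS : 0 < legendreAux (1 / (4 * n * K₁)) u y)
    (hSK : legendreAux (1 / (4 * n * K₁)) u y ≤ K₁ + K₃)
    (huS : -u y + 1 / (4 * n * K₁) * ‖fderiv ℝ u y‖ ^ 2
      ≤ (4 * n + 3) * legendreAux (1 / (4 * n * K₁)) u y)
    (hτ : 0 < τ) (huτ : u y < -τ)
    (hmin : IsLocalMin (fun z => hessRoot u z * legendreAux (1 / (4 * n * K₁)) u z
      + hessRoot u y * legendreAux (1 / (4 * n * K₁)) u y / (-u y - τ) * u z) y) :
    1 / (1 + (((K₁ + K₃) * K₂ * (4 * n + 3) ^ 2 + 2 * n * (4 * n + 3))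
        / (2 * (1 / (4 * n * K₁)))) ^ n * (4 * n + 3 : ℝ) ^ 2)
      * ((-u y - τ) / legendreAux (1 / (4 * n * K₁)) u y) ≤ hessRoot u y := by
  have hn' : (0 : ℝ) < n := by exact_mod_cast hn
  have hposy := hpos.self_of_nhds
  have hρ := hessRoot_pos hposy
  have htr := trace_hess_le_of_isLocalMin hu hpos hS hmin
  have hsum : ∑ k, (y k - 2 * (1 / (4 * n * K₁)) * pd k u y) * pd k u y
      = legendreAux (1 / (4 * n * K₁)) u y + u y - 1 / (4 * n * K₁) * ‖fderiv ℝ u y‖ ^ 2 := by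
    have h1 : ∑ k, pd k u y ^ 2 = ‖fderiv ℝ u y‖ ^ 2 := (clm_norm_sq_eq_sum _).symm
    rw [legendreAux, h1, ← h1]
    simp only [sub_mul, Finset.sum_sub_distrib, Finset.mul_sum]
    have h2 : ∀ k, 2 * (1 / (4 * n * K₁)) * pd k u y * pd k u y
        = 2 * (1 / (4 * n * K₁) * pd k u y ^ 2) := fun k => by ring
    simp_rw [h2, ← Finset.mul_sum]
    ring
  rw [hsum] at htr
  have hε : 0 < 1 / (4 * n * K₁) := by positivity
  set ε := 1 / (4 * n * K₁) with hεdef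
  set S := legendreAux ε u y with hSdef
  set ρ := hessRoot u y with hρdef
  set P := ‖fderiv ℝ u y‖ with hPdef
  have hη : 0 < -u y - τ := by linarith
  set η := -u y - τ with hηdef
  have hN : (1 : ℝ) ≤ 4 * n + 3 := by linarith
  have hr : 0 < η / S := div_pos hη hS
  have hεP : 0 ≤ ε * P ^ 2 := by positivity
  have hrN : η / S ≤ 4 * n + 3 := by
    rw [div_le_iff₀ hS]
    linarith
  refine mul_le_of_trace_bound (D := (Hess u y).det) (t := (Hess u y).trace)
    (by positivity) hρ hr hrN hN (by positivity) (by positivity)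
    hposy.posSemidef.trace_nonneg (det_mul_hessRoot_pow hposy) (det_le_trace_pow hposy)
    (htr.trans ?_)
  have h1 : S * Lop n u y * ρ / (n + 1) ≤ (K₁ + K₃) * K₂ * ρ := by
    have h2 : S * Lop n u y ≤ (K₁ + K₃) * K₂ :=
      (mul_le_mul_of_nonneg_left hL hS.le).trans (mul_le_mul_of_nonneg_right hSK hK₂.le)
    rw [div_le_iff₀ (by positivity)]
    have h3 := mul_le_mul_of_nonneg_right h2 hρ.le
    have h4 : 0 ≤ (K₁ + K₃) * K₂ * ρ * n := by positivity
    linarith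
  have h2 : n * (ρ * S / η) / ρ * (1 - (S + u y - ε * P ^ 2) / S)
      = n * (-u y + ε * P ^ 2) / η := by
    field_simp
    ring
  have h3 : n * (-u y + ε * P ^ 2) / η ≤ n * (4 * n + 3) / (η / S) := by
    rw [div_div_eq_mul_div, div_le_div_iff_of_pos_right hη, mul_assoc]
    exact mul_le_mul_of_nonneg_left huS hn'.le
  have h4 : (n : ℝ) ≤ n * (4 * n + 3) / (η / S) := by
    rw [le_div_iff₀ hr]
    exact mul_le_mul_of_nonneg_left hrN hn'.le
  have h5 : 2 * n * (4 * n + 3) / (η / S)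
      = n * (4 * n + 3) / (η / S) + n * (4 * n + 3) / (η / S) := by ring
  rw [h2, h5]
  linarith

end InteriorEstimate

/-- **Interior upper bound (2.2)** for `det D²u` for solutions of the prescribed affine mean
curvature equation `L[u] = f` vanishing on the boundary of a normalized convex domain. -/
theorem det_hessian_interior_upper_bound
    (n : ℕ) (hn : 2 ≤ n) (δ K₁ K₂ K₃ : ℝ)
    (hδ : 0 < δ) (hK₁ : 0 < K₁) (hK₂ : 0 < K₂) (hK₃ : 0 < K₃) :
    ∃ C > 0, ∀ (Ω : Set (E n)) (u f : E n → ℝ),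
      IsOpen Ω → Convex ℝ Ω →
      Metric.ball (0 : E n) (1 / n) ⊆ Ω → Ω ⊆ Metric.ball (0 : E n) 1 →
      ContDiffOn ℝ 4 u Ω → ContinuousOn u (closure Ω) →
      (∀ x ∈ Ω, (Hess u x).PosDef) →
      (∀ x ∈ frontier Ω, u x = 0) →
      (∀ x ∈ Ω, Lop n u x = f x) →
      (∀ x ∈ Ω, ‖fderiv ℝ u x‖ ≤ K₁) →
      (∀ x ∈ Ω, f x ≤ K₂) →
      (∀ x ∈ Ω, |u x| ≤ K₃) →
      ∀ x ∈ Ω, δ ≤ Metric.infDist x (frontier Ω) → (Hess u x).det ≤ C := by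
  have hn0 : 0 < n := by omega
  set κ : ℝ := 1 / (1 + (((K₁ + K₃) * K₂ * (4 * n + 3) ^ 2 + 2 * n * (4 * n + 3))
    / (2 * (1 / (4 * n * K₁)))) ^ n * (4 * n + 3 : ℝ) ^ 2) with hκ
  have hκ0 : 0 < κ := by positivity
  refine ⟨((κ / (2 * (1 + 2 / δ))) ^ (n + 2))⁻¹, by positivity, ?_⟩
  intro Ω u f hΩ hconv hin hout hu hcont hpos hbd hLf hgrad hf hsup x hx hxδ
  have hbdd : Bornology.IsBounded Ω := Metric.isBounded_ball.subset hout
  have hneg : ∀ z ∈ Ω, u z < 0 := fun z hz =>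
    neg_of_posDef_of_frontier_eq_zero hn0 hΩ hbdd hu hcont hpos hbd hz
  have hat : ∀ z ∈ Ω, ContDiffAt ℝ 4 u z := fun z hz => hu.contDiffAt (hΩ.mem_nhds hz)
  have hbounds := fun z (hz : z ∈ Ω) =>
    legendreAux_bounds hn0 hΩ hconv hin hout hu hpos hneg hK₁ hgrad hsup hz
  have hux := hneg x hx
  obtain ⟨y, hy, hyτ, hmin, hxy⟩ := exists_isLocalMin_of_sublevel (τ := -u x / 2)
    (S := legendreAux (1 / (4 * n * K₁)) u) (ρ := hessRoot u) hΩ hbdd hcont hbd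
    (by linarith) hx (by linarith)
    (fun z hz => (((hat z hz).legendreAux (k := 3)
      (by norm_num)).continuousAt).continuousWithinAt)
    (fun z hz => (contDiffAt_hessRoot (hat z hz) (hpos z hz)).continuousAt.continuousWithinAt)
    (fun z hz => (hbounds z hz).1) (fun z hz => hessRoot_pos (hpos z hz))
  obtain ⟨hSy, hSyK, -, huSy⟩ := hbounds y hy
  obtain ⟨hSx, -, hSxP, -⟩ := hbounds x hx
  have hρy := mul_le_hessRoot_of_isLocalMin hn0 hK₁ hK₂ hK₃ (hat y hy)
    (Filter.eventually_of_mem (hΩ.mem_nhds hy) hpos) ((hLf y hy).trans_le (hf y hy))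
    hSy hSyK huSy (by linarith) hyτ hmin
  rw [← hκ] at hρy
  have hρx0 := hessRoot_pos (hpos x hx)
  have hρy0 := hessRoot_pos (hpos y hy)
  have hgradx : ‖fderiv ℝ u x‖ * (δ / 2) ≤ -u x := by
    refine norm_mul_le_of_forall_apply_le (by positivity) fun v hv => ?_
    have hvΩ : x + v ∈ Ω := ball_subset_of_le_infDist_frontier hΩ hδ hx hxδ (by
      rw [mem_ball_iff_norm, add_sub_cancel_left]
      linarith)
    have h := add_fderiv_le_of_posDef hΩ hconv hu hpos hx hvΩ
    rw [add_sub_cancel_left] at h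
    linarith [hneg _ hvΩ]
  have hSxu : legendreAux (1 / (4 * n * K₁)) u x ≤ (1 + 2 / δ) * -u x := by
    have h1 : ‖fderiv ℝ u x‖ ≤ -u x / (δ / 2) := (le_div_iff₀ (by positivity)).2 hgradx
    have h2 : -u x / (δ / 2) = 2 / δ * -u x := by field_simp
    linarith
  have hρx : κ / (2 * (1 + 2 / δ)) ≤ hessRoot u x := by
    set Sx := legendreAux (1 / (4 * n * K₁)) u x
    set Sy := legendreAux (1 / (4 * n * K₁)) u y
    have h1 : κ * ((-u y - -u x / 2) / (hessRoot u y * Sy)) ≤ 1 := by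
      rw [mul_comm (hessRoot u y), ← div_div, ← mul_div_assoc, div_le_one hρy0]
      exact hρy
    have h2 := (mul_le_mul_of_nonneg_left hxy hκ0.le).trans h1
    rw [← mul_div_assoc, div_le_one (mul_pos hρx0 hSx)] at h2
    rw [div_le_iff₀ (by positivity)]
    have h3 := mul_le_mul_of_nonneg_left hSxu hρx0.le
    refine le_of_mul_le_mul_right ?_ (neg_pos.2 hux)
    linarith
  rw [le_inv_comm₀ (hpos x hx).det_pos (by positivity),
    ← eq_inv_of_mul_eq_one_right (det_mul_hessRoot_pow (hpos x hx))]
  exact pow_le_pow_left₀ (by positivity) hρx _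

end
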